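/- For every n ≥ 0, M(8n+1) = M(8n) + 1, where M(m) is the maximum of Δ(w) = |w|_0 − |w|_1 over all factors w of the ordinary paperfolding word of length m. -/

import Mathlib

/-- The ordinary paperfolding word over `{0,1}`, indexed from 1:
writing `n = n' * 2^k` with `n'` odd, `pf n = 0` if `n' ≡ 1 (mod 4)`
and `pf n = 1` if `n' ≡ 3 (mod 4)`.  (The value at `0` is irrelevant.) -/
def pf (n : ℕ) : ℕ := if (n / 2 ^ (n.factorization 2)) % 4 = 1 then 0 else 1

/-- The factor `f_i f_{i+1} ⋯ f_{i+n-1}` of the paperfolding word,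
of length `n`, starting at position `i`. -/
def pfFactor (i n : ℕ) : List ℕ := (List.range n).map (fun j => pf (i + j))

/-- `w` is a factor of the ordinary paperfolding word. -/
def IsPFFactor (w : List ℕ) : Prop := ∃ i : ℕ, 1 ≤ i ∧ w = pfFactor i w.length

/-- The abelian complexity function of the ordinary paperfolding word:
the number of abelian equivalence classes of factors of length `n`,
where the class of a factor `w` is determined by the pair
`(|w|_0, |w|_1)` of numbers of occurrences of `0` and `1` in `w`. -/
noncomputable def ρ (n : ℕ) : ℕ :=
  {p : ℕ × ℕ | ∃ i : ℕ, 1 ≤ i ∧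
    p = ((pfFactor i n).count 0, (pfFactor i n).count 1)}.ncard

/-- `Δ w = |w|_0 - |w|_1`. -/
def Δ (w : List ℕ) : ℤ := (w.count 0 : ℤ) - (w.count 1 : ℤ)

/-- `M n` is the maximum of `Δ w` over all factors `w` of the
paperfolding word of length `n`. -/
noncomputable def M (n : ℕ) : ℤ :=
  sSup {d : ℤ | ∃ i : ℕ, 1 ≤ i ∧ d = Δ (pfFactor i n)}

theorem pf_eq_zero_or_one (m : ℕ) : pf m = 0 ∨ pf m = 1 := by
  unfold pf; split_ifs <;> simp

theorem pf_of_odd {m : ℕ} (h : m % 2 = 1) : pf m = if m % 4 = 1 then 0 else 1 := by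
  have h0 : m.factorization 2 = 0 := Nat.factorization_eq_zero_of_not_dvd (by omega)
  simp [pf, h0]

theorem pf_two_mul_of_odd {m : ℕ} (h : m % 2 = 1) : pf (2 * m) = pf m := by
  have h0 : m.factorization 2 = 0 := Nat.factorization_eq_zero_of_not_dvd (by omega)
  have h1 : (2 * m).factorization 2 = 1 := by
    rw [Nat.factorization_mul (by norm_num) (by omega)]
    simp [h0, Nat.prime_two.factorization]
  simp [pf, h0, h1]

/-- Away from the multiples of `4`, the paperfolding word is `8`-periodic. -/
theorem pf_add_eight_mul {m : ℕ} (h : m % 4 ≠ 0) (n : ℕ) : pf (m + 8 * n) = pf m := by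
  rcases Nat.mod_two_eq_zero_or_one m with h2 | h2
  · obtain ⟨k, rfl⟩ : ∃ k, m = 2 * k := ⟨m / 2, by omega⟩
    rw [show 2 * k + 8 * n = 2 * (k + 4 * n) by ring, pf_two_mul_of_odd (by omega),
      pf_two_mul_of_odd (by omega), pf_of_odd (by omega), pf_of_odd (by omega)]
    simp
  · rw [pf_of_odd (by omega), pf_of_odd h2, show (m + 8 * n) % 4 = m % 4 by omega]

theorem Δ_pfFactor (i n : ℕ) :
    Δ (pfFactor i n) = ∑ j ∈ Finset.range n, (1 - 2 * (pf (i + j) : ℤ)) := by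
  induction n with
  | zero => simp [pfFactor, Δ]
  | succ n ih =>
    rw [Finset.sum_range_succ, ← ih]
    rcases pf_eq_zero_or_one (i + n) with h | h <;>
      simp [pfFactor, Δ, List.range_succ, h] <;> ring

theorem Δ_pfFactor_succ (i n : ℕ) :
    Δ (pfFactor i (n + 1)) = Δ (pfFactor i n) + (1 - 2 * (pf (i + n) : ℤ)) := by
  simp only [Δ_pfFactor, Finset.sum_range_succ]

theorem Δ_pfFactor_shift (i n : ℕ) :
    Δ (pfFactor (i + 1) n) + (1 - 2 * (pf i : ℤ)) =
      Δ (pfFactor i n) + (1 - 2 * (pf (i + n) : ℤ)) := by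
  rw [← Δ_pfFactor_succ, Δ_pfFactor, Δ_pfFactor, Finset.sum_range_succ']
  simp [add_assoc, add_comm 1]

theorem Δ_pfFactor_le (i n : ℕ) : Δ (pfFactor i n) ≤ n := by
  have h := List.count_le_length (a := 0) (l := pfFactor i n)
  simp only [pfFactor, List.length_map, List.length_range] at h
  simp only [Δ, pfFactor]
  omega

theorem bddAbove_Δ_pfFactor (n : ℕ) :
    BddAbove {d : ℤ | ∃ i : ℕ, 1 ≤ i ∧ d = Δ (pfFactor i n)} :=
  ⟨n, by rintro _ ⟨i, -, rfl⟩; exact Δ_pfFactor_le i n⟩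

theorem Δ_pfFactor_le_M {i : ℕ} (hi : 1 ≤ i) (n : ℕ) : Δ (pfFactor i n) ≤ M n :=
  le_csSup (bddAbove_Δ_pfFactor n) ⟨i, hi, rfl⟩

theorem exists_Δ_pfFactor_eq_M (n : ℕ) : ∃ i, 1 ≤ i ∧ M n = Δ (pfFactor i n) :=
  Int.csSup_mem (s := {d : ℤ | ∃ i : ℕ, 1 ≤ i ∧ d = Δ (pfFactor i n)})
    ⟨_, 1, le_rfl, rfl⟩ (bddAbove_Δ_pfFactor n)

theorem Δ_pfFactor_succ_eight_mul {i : ℕ} (h : i % 4 ≠ 0) (n : ℕ) :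
    Δ (pfFactor (i + 1) (8 * n)) = Δ (pfFactor i (8 * n)) := by
  have := Δ_pfFactor_shift i (8 * n)
  rw [pf_add_eight_mul h] at this
  linarith

/-- Every factor of length `8n` has the same `Δ` as one starting at a position `≡ 1 (mod 4)`. -/
theorem exists_Δ_pfFactor_eight_mul_eq {i : ℕ} (hi : 1 ≤ i) (n : ℕ) :
    ∃ k, Δ (pfFactor i (8 * n)) = Δ (pfFactor (4 * k + 1) (8 * n)) := by
  refine ⟨(i - 1) / 4, ?_⟩
  obtain ⟨k, r, hr, rfl⟩ : ∃ k r, r < 4 ∧ i = 4 * k + 1 + r :=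
    ⟨(i - 1) / 4, (i - 1) % 4, by omega, by omega⟩
  rw [show (4 * k + 1 + r - 1) / 4 = k by omega]
  induction r with
  | zero => rfl
  | succ r ih =>
    rw [← add_assoc, Δ_pfFactor_succ_eight_mul (by omega), ih (by omega) (by omega)]

/-- For every `n ≥ 0`, `M(8n+1) = M(8n) + 1`. -/
theorem pf_M_eight_mul_add_one : ∀ n : ℕ, M (8 * n + 1) = M (8 * n) + 1 := by
  intro n
  apply le_antisymm
  · obtain ⟨i, hi, h⟩ := exists_Δ_pfFactor_eq_M (8 * n + 1)
    rw [h, Δ_pfFactor_succ]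
    have := Δ_pfFactor_le_M hi (8 * n)
    omega
  · obtain ⟨i, hi, h⟩ := exists_Δ_pfFactor_eq_M (8 * n)
    obtain ⟨k, hk⟩ := exists_Δ_pfFactor_eight_mul_eq hi n
    have hpf : pf (4 * k + 1 + 8 * n) = 0 := by
      rw [pf_of_odd (by omega), if_pos (by omega)]
    have := Δ_pfFactor_le_M (i := 4 * k + 1) (by omega) (8 * n + 1)
    rw [Δ_pfFactor_succ, hpf] at this
    simp only [Nat.cast_zero] at this
    omega
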